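/- arXiv:2509.07761 — 3 statements merged into one kernel-verified Lean document; each statement's English description precedes it below -/
import Mathlib

section
/- Let C_1 ⊆ F_q^{n_1} and C_2 ⊆ F_q^{n_2} be linear codes. Then the dual of the tensor product code C_1 ⊗ C_2 equals the check-product C_1^⊥ ⊞ C_2^⊥ := C_1^⊥ ⊗ F_q^{n_2} + F_q^{n_1} ⊗ C_2^⊥. -/
noncomputable def dualCode (F : Type*) [Field F] {ι : Type*} [Fintype ι]
    (C : Submodule F (ι → F)) : Submodule F (ι → F) where
  carrier := {x | ∀ c ∈ C, ∑ i, x i * c i = 0}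
  zero_mem' := by intro c _; simp
  add_mem' := by
    intro x y hx hy c hc
    simp only [Pi.add_apply, add_mul, Finset.sum_add_distrib]
    rw [hx c hc, hy c hc, add_zero]
  smul_mem' := by
    intro a x hx c hc
    simp only [Pi.smul_apply, smul_eq_mul, mul_assoc, ← Finset.mul_sum]
    rw [hx c hc, mul_zero]

noncomputable def minDist (F : Type*) [Field F] {ι : Type*} [Fintype ι] [DecidableEq F]
    (C : Submodule F (ι → F)) : ℕ :=
  sInf {w | ∃ c ∈ C, c ≠ 0 ∧ hammingNorm c = w}

/-- The weight of a matrix codeword: the number of nonzero entries. -/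
noncomputable def wt2 {F : Type*} [Zero F] [DecidableEq F] {ι₁ ι₂ : Type*} [Fintype ι₁]
    [Fintype ι₂] (m : ι₂ → ι₁ → F) : ℕ :=
  hammingNorm (fun p : ι₂ × ι₁ => m p.1 p.2)

noncomputable def minDist2 (F : Type*) [Field F] [DecidableEq F] {ι₁ ι₂ : Type*} [Fintype ι₁]
    [Fintype ι₂] (C : Submodule F (ι₂ → ι₁ → F)) : ℕ :=
  sInf {w | ∃ m ∈ C, m ≠ 0 ∧ wt2 m = w}

noncomputable def dualCode2 (F : Type*) [Field F] {ι₁ ι₂ : Type*} [Fintype ι₁] [Fintype ι₂]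
    (C : Submodule F (ι₂ → ι₁ → F)) : Submodule F (ι₂ → ι₁ → F) where
  carrier := {x | ∀ c ∈ C, ∑ i, ∑ j, x i j * c i j = 0}
  zero_mem' := by intro c _; simp
  add_mem' := by
    intro x y hx hy c hc
    simp only [Pi.add_apply, add_mul, Finset.sum_add_distrib]
    rw [hx c hc, hy c hc, add_zero]
  smul_mem' := by
    intro a x hx c hc
    simp only [Pi.smul_apply, smul_eq_mul, mul_assoc, ← Finset.mul_sum]
    rw [hx c hc, mul_zero]

/-- Transposition of matrices (as iterated function types), as a linear map. -/
def transposeLM (F : Type*) [Field F] {ι₁ ι₂ : Type*} :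
    (ι₂ → ι₁ → F) →ₗ[F] (ι₁ → ι₂ → F) where
  toFun m := fun j i => m i j
  map_add' _ _ := rfl
  map_smul' _ _ := rfl

/-- The matrices all of whose rows lie in the code `C`. -/
def rowsIn (F : Type*) [Field F] {ι₁ : Type*} (ι₂ : Type*) (C : Submodule F (ι₁ → F)) :
    Submodule F (ι₂ → ι₁ → F) :=
  Submodule.pi Set.univ fun _ : ι₂ => C

/-- The matrices all of whose columns lie in the code `C`. -/
def colsIn (F : Type*) [Field F] {ι₂ : Type*} (ι₁ : Type*) (C : Submodule F (ι₂ → F)) :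
    Submodule F (ι₂ → ι₁ → F) :=
  (rowsIn F ι₁ C).comap (transposeLM F)

/-- The tensor product code `C₁ ⊗ C₂`: matrices whose rows are in `C₁` and columns in `C₂`. -/
def tensorCode (F : Type*) [Field F] {ι₁ ι₂ : Type*} (C₁ : Submodule F (ι₁ → F))
    (C₂ : Submodule F (ι₂ → F)) : Submodule F (ι₂ → ι₁ → F) :=
  rowsIn F ι₂ C₁ ⊓ colsIn F ι₁ C₂

/-- The check-product `C₁ ⊞ C₂ = C₁ ⊗ F^{n₂} + F^{n₁} ⊗ C₂`. -/
def checkProd (F : Type*) [Field F] {ι₁ ι₂ : Type*} (C₁ : Submodule F (ι₁ → F))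
    (C₂ : Submodule F (ι₂ → F)) : Submodule F (ι₂ → ι₁ → F) :=
  rowsIn F ι₂ C₁ ⊔ colsIn F ι₁ C₂

/-- the dual of the tensor product code `C₁ ⊗ C₂` is the check-product
`C₁^⊥ ⊞ C₂^⊥ = C₁^⊥ ⊗ F^{n₂} + F^{n₁} ⊗ C₂^⊥`. -/
theorem tensorCode_dual (F : Type*) [Field F] {n₁ n₂ : ℕ}
    (C₁ : Submodule F (Fin n₁ → F)) (C₂ : Submodule F (Fin n₂ → F)) :
    dualCode2 F (tensorCode F C₁ C₂) = checkProd F (dualCode F C₁) (dualCode F C₂) := by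
  apply le_antisymm
  · intro X hX
    obtain ⟨p, hp⟩ := C₁.subtype.exists_leftInverse_of_injective (by simp)
    have hp' : ∀ c (hc : c ∈ C₁), p c = ⟨c, hc⟩ := fun c hc =>
      LinearMap.congr_fun hp ⟨c, hc⟩
    let e : Fin n₁ → Fin n₁ → F := fun j => (p (Pi.single j 1) : Fin n₁ → F)
    have he : ∀ j, e j ∈ C₁ := fun j => (p (Pi.single j 1)).2
    have hexp : ∀ c ∈ C₁, ∀ k, ∑ j, e j k * c j = c k := by
      intro c hc k
      have h1 : c = ∑ j, c j • (Pi.single j 1 : Fin n₁ → F) := pi_eq_sum_univ' c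
      have h2 : p c = ∑ j, c j • p (Pi.single j 1) := by
        conv_lhs => rw [h1]
        simp only [map_sum, map_smul]
      rw [hp' c hc] at h2
      have h3 := congrArg (fun z : C₁ => (z : Fin n₁ → F) k) h2
      simp only [AddSubmonoidClass.coe_finsetSum, Submodule.coe_smul, Finset.sum_apply,
        Pi.smul_apply, smul_eq_mul] at h3
      rw [h3]
      exact Finset.sum_congr rfl fun j _ => mul_comm _ _
    let Y : Fin n₂ → Fin n₁ → F := fun i j => ∑ k, X i k * e j k
    refine Submodule.mem_sup.2 ⟨X - Y, ?_, Y, ?_, sub_add_cancel X Y⟩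
    · intro i _ c hc
      have : ∑ j, Y i j * c j = ∑ k, X i k * c k := by
        simp only [Y, Finset.sum_mul]
        rw [Finset.sum_comm]
        refine Finset.sum_congr rfl fun k _ => ?_
        rw [← hexp c hc k, Finset.mul_sum]
        refine Finset.sum_congr rfl fun j _ => ?_
        rw [mul_assoc]
      simp only [Pi.sub_apply, sub_mul, Finset.sum_sub_distrib]
      rw [this, sub_self]
    · intro j _ c hc
      have h := hX (fun i k => c i * e j k) ⟨?_, ?_⟩
      · change ∑ i, Y i j * c i = 0
        rw [← h]
        refine Finset.sum_congr rfl fun i _ => ?_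
        simp only [Y, Finset.sum_mul]
        exact Finset.sum_congr rfl fun k _ => by ring
      · intro i _
        exact C₁.smul_mem (c i) (he j)
      · intro k _
        have := C₂.smul_mem (e j k) hc
        have h2 : (fun i => c i * e j k) = e j k • c := by
          ext i
          exact mul_comm _ _
        rw [← h2] at this
        exact this
  · refine sup_le ?_ ?_
    · intro X hX c hc
      exact Finset.sum_eq_zero fun i _ => hX i trivial _ (hc.1 i trivial)
    · intro X hX c hc
      rw [Finset.sum_comm]
      exact Finset.sum_eq_zero fun j _ => hX j trivial _ (hc.2 j trivial)
end

section
/- Let C_1 ⊆ F_q^{n_1} and C_2 ⊆ F_q^{n_2} be linear codes with minimum distances d_1 and d_2 satisfying 2 ≤ d_1 < d_2, and let C = C_1 ⊞ C_2 = C_1 ⊗ F_q^{n_2} + F_q^{n_1} ⊗ C_2. Then every nonzero codeword of C of minimum weight (= d_1) is an n_2 × n_1 matrix having exactly one nonzero row, and that row is a word of C_1 of Hamming weight d_1. -/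
/-- if `2 ≤ d₁ < d₂`, every nonzero codeword of the check-product
`C = C₁ ⊞ C₂` of minimum weight (which is `d₁`) has exactly one nonzero row, and this row
is a word of `C₁` of Hamming weight `d₁`. -/
theorem checkProd_min_weight_words (F : Type*) [Field F] [DecidableEq F] {n₁ n₂ : ℕ}
    (C₁ : Submodule F (Fin n₁ → F)) (C₂ : Submodule F (Fin n₂ → F))
    (hd1 : 2 ≤ minDist F C₁) (hd12 : minDist F C₁ < minDist F C₂) :
    ∀ m ∈ checkProd F C₁ C₂, m ≠ 0 → wt2 m = minDist2 F (checkProd F C₁ C₂) →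
      wt2 m = minDist F C₁ ∧
      ∃ i, m i ∈ C₁ ∧ hammingNorm (m i) = minDist F C₁ ∧ ∀ j, j ≠ i → m j = 0 := by 
  have hlow1 : ∀ c ∈ C₁, c ≠ 0 → minDist F C₁ ≤ hammingNorm c := fun c hc h0 =>
    Nat.sInf_le ⟨c, hc, h0, rfl⟩
  have hlow2 : ∀ c ∈ C₂, c ≠ 0 → minDist F C₂ ≤ hammingNorm c := fun c hc h0 =>
    Nat.sInf_le ⟨c, hc, h0, rfl⟩
  have hwt : ∀ m : Fin n₂ → Fin n₁ → F, wt2 m = ∑ i, hammingNorm (m i) := by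
    intro m
    simp only [wt2, hammingNorm, Finset.card_filter, Fintype.sum_prod_type]
  intro m hm hm0 hmin
  -- the minimum distance of the check-product is at most `d₁`
  have hle : wt2 m ≤ minDist F C₁ := by
    have hne1 : {w | ∃ c ∈ C₁, c ≠ 0 ∧ hammingNorm c = w}.Nonempty := by
      apply Nat.nonempty_of_pos_sInf
      change 0 < minDist F C₁
      omega
    obtain ⟨c, hc, hc0, hcw⟩ := Nat.sInf_mem hne1
    obtain ⟨i₀, hi₀⟩ : ∃ i, m i ≠ 0 := Function.ne_iff.mp hm0
    rw [hmin]
    apply Nat.sInf_le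
    refine ⟨Pi.single i₀ c, ?_, ?_, ?_⟩
    · apply Submodule.mem_sup_left
      intro i _
      by_cases h : i = i₀
      · subst h; simpa using hc
      · simp [h]
    · simpa using hc0
    · rw [hwt, Finset.sum_eq_single i₀]
      · rw [Pi.single_eq_same]; exact hcw
      · intro b _ hb
        simp [hb]
      · simp
  -- every row lies in `C₁`
  have hrows : ∀ i, m i ∈ C₁ := by
    intro i
    by_contra hi
    obtain ⟨f, hf, hfC⟩ := Submodule.exists_le_ker_of_notMem hi
    obtain ⟨A, hA, B, hB, rfl⟩ := Submodule.mem_sup.mp hm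
    have hv : (fun k => f ((A + B) k)) ∈ C₂ := by
      have : (fun k => f ((A + B) k)) =
          ∑ j, f (Pi.single j 1) • (fun k => B k j) := by
        funext k
        have hAk : f (A k) = 0 := hfC (hA k (Set.mem_univ k))
        rw [Pi.add_apply, map_add, hAk, zero_add, LinearMap.pi_apply_eq_sum_univ f (B k)]
        simp only [Finset.sum_apply, Pi.smul_apply, smul_eq_mul]
        refine Finset.sum_congr rfl fun j _ => ?_
        rw [mul_comm]
        congr 2
        funext l
        simp [Pi.single_apply, eq_comm]
      rw [this]
      exact Submodule.sum_mem _ fun j _ => C₂.smul_mem _ (hB j (Set.mem_univ j))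
    have h1 := hlow2 _ hv (fun h => hf (congrFun h i))
    have h2 : hammingNorm (fun k => f ((A + B) k)) ≤ wt2 (A + B) := by
      rw [hwt]
      simp only [hammingNorm, Finset.card_filter]
      refine Finset.sum_le_sum fun k _ => ?_
      split_ifs with hk
      · rw [← Finset.card_filter]
        apply Nat.one_le_iff_ne_zero.mpr
        intro h0
        exact hk (by rw [hammingNorm_eq_zero.mp h0, map_zero])
      · exact Nat.zero_le _
    omega
  obtain ⟨i, hi⟩ : ∃ i, m i ≠ 0 := Function.ne_iff.mp hm0
  have h1 := hlow1 _ (hrows i) hi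
  have h2 := Finset.add_sum_erase Finset.univ (fun k => hammingNorm (m k)) (Finset.mem_univ i)
  rw [← hwt] at h2
  refine ⟨by omega, i, hrows i, by omega, fun j hj => ?_⟩
  have h3 : ∑ k ∈ Finset.univ.erase i, hammingNorm (m k) = 0 := by omega
  exact hammingNorm_eq_zero.mp
    (Finset.sum_eq_zero_iff.mp h3 j (Finset.mem_erase.mpr ⟨hj, Finset.mem_univ j⟩))
end

section
/- Let e ≥ 1 and a,b ∈ ℕ with b - ea ≥ 0. Then C_{A,e}(a,b)^⊥ = C_1 + C_2, where C_1 = Σ_{d=0}^{q-1} span{(α_1^d,…,α_q^d)} ⊗ RS_q(q-1-b+e(q-1-d)) and C_2 = RS_q(q-a-1) ⊗ F_q^q, inside F_q^{q^2}. -/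
/-- The affine Reed–Solomon code `RS_q(k)`: evaluations of polynomials of degree `< k` at
all elements of `F`.  By convention it is `{0}` for `k ≤ 0` and the full space for `k ≥ q`. -/
noncomputable def RS (F : Type*) [Field F] (k : ℤ) : Submodule F (F → F) :=
  (Polynomial.degreeLT F k.toNat).map
    (LinearMap.pi fun α : F => (Polynomial.aeval α).toLinearMap)

/-- The linear map `c ↦ v ⊗ c`, sending a word `c` to the matrix `(v i * c j)_{i,j}`. -/
noncomputable def vTensor (F : Type*) [Field F] {ι₁ ι₂ : Type*} (v : ι₁ → F) :
    (ι₂ → F) →ₗ[F] (ι₁ → ι₂ → F) where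
  toFun c := fun i j => v i * c j
  map_add' c d := by funext i j; simp [mul_add]
  map_smul' a c := by funext i j; simp only [Pi.smul_apply, smul_eq_mul, RingHom.id_apply]; ring

/-- The code `C_{𝔸,e}(a,b) = Σ_{d=0}^{a} ⟨(α^d)_α⟩ ⊗ RS_q(b - ed + 1) ⊆ F^{q²}`,
the evaluation code on the affine chart of the Hirzebruch surface `H_e`.  A codeword is a
matrix indexed by `F × F`, the entry at `(α, β)` being `α^d · f(β)`. -/
noncomputable def CA (F : Type*) [Field F] (e a b : ℕ) : Submodule F (F → F → F) :=
  ⨆ d ∈ Finset.Iic a, (RS F ((b : ℤ) - e * d + 1)).map (vTensor F fun α : F => α ^ d)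

theorem sum_eval_zero (F : Type*) [Field F] [Fintype F] (p : Polynomial F)
    (hp : p.natDegree < Fintype.card F - 1) : ∑ x : F, p.eval x = 0 := by
  simp only [Polynomial.eval_eq_sum_range]
  rw [Finset.sum_comm]
  refine Finset.sum_eq_zero fun i hi => ?_
  rw [← Finset.mul_sum, FiniteField.sum_pow_lt_card_sub_one F i, mul_zero]
  have := Finset.mem_range.1 hi
  omega

theorem mem_RS_iff (F : Type*) [Field F] (k : ℤ) (f : F → F) :
    f ∈ RS F k ↔ ∃ p : Polynomial F, p.degree < (k.toNat : ℕ) ∧ ∀ x, f x = p.eval x := by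
  unfold RS
  rw [Submodule.mem_map]
  constructor
  · rintro ⟨p, hp, rfl⟩
    exact ⟨p, Polynomial.mem_degreeLT.1 hp, fun x => by simp [Polynomial.aeval_def, Polynomial.eval₂_eq_eval_map]⟩
  · rintro ⟨p, hp, h⟩
    refine ⟨p, Polynomial.mem_degreeLT.2 hp, ?_⟩
    funext x
    rw [h x]
    simp [Polynomial.aeval_def, Polynomial.eval₂_eq_eval_map]

theorem RS_mono (F : Type*) [Field F] {k l : ℤ} (h : k ≤ l) : RS F k ≤ RS F l := by
  intro f hf
  rw [mem_RS_iff] at hf ⊢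
  obtain ⟨p, hp, h'⟩ := hf
  refine ⟨p, lt_of_lt_of_le hp ?_, h'⟩
  exact_mod_cast Int.toNat_le_toNat h

theorem pow_mem_RS (F : Type*) [Field F] (k : ℤ) (j : ℕ) (h : (j : ℤ) < k) :
    (fun x : F => x ^ j) ∈ RS F k := by
  rw [mem_RS_iff]
  refine ⟨Polynomial.X ^ j, ?_, fun x => by simp⟩
  rw [Polynomial.degree_X_pow]
  have : j < k.toNat := by omega
  exact_mod_cast this

theorem RS_orth (F : Type*) [Field F] [Fintype F] (k l : ℤ) (f g : F → F)
    (hf : f ∈ RS F k) (hg : g ∈ RS F l) (h : k + l ≤ Fintype.card F) :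
    ∑ x, f x * g x = 0 := by
  rw [mem_RS_iff] at hf hg
  obtain ⟨p, hp, hfp⟩ := hf
  obtain ⟨r, hr, hgr⟩ := hg
  simp only [hfp, hgr, ← Polynomial.eval_mul]
  by_cases hp0 : p = 0
  · simp [hp0]
  by_cases hr0 : r = 0
  · simp [hr0]
  apply sum_eval_zero
  rw [Polynomial.natDegree_mul hp0 hr0]
  rw [Polynomial.degree_eq_natDegree hp0] at hp
  rw [Polynomial.degree_eq_natDegree hr0] at hr
  have h1 : p.natDegree < k.toNat := by exact_mod_cast hp
  have h2 : r.natDegree < l.toNat := by exact_mod_cast hr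
  omega

/-- The dual basis of the monomials (up to sign). -/
noncomputable def dualMon (F : Type*) [Field F] (q u : ℕ) (y : F) : F :=
  y ^ (q - 1 - u) - if u = 0 then 1 else 0

theorem dualMon_sum (F : Type*) [Field F] [Fintype F] [DecidableEq F] (x y : F) :
    ∑ u ∈ Finset.range (Fintype.card F), x ^ u * dualMon F (Fintype.card F) u y
      = if x = y then -1 else 0 := by
  have hpos : 0 < Fintype.card F := Fintype.card_pos
  have h0 : ∑ u ∈ Finset.range (Fintype.card F), x ^ u * dualMon F (Fintype.card F) u y
      = (∑ u ∈ Finset.range (Fintype.card F), x ^ u * y ^ (Fintype.card F - 1 - u)) - 1 := by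
    simp only [dualMon, mul_sub, Finset.sum_sub_distrib]
    congr 1
    simp [hpos.ne']
  rw [h0]
  split_ifs with h
  · subst h
    have : ∀ u ∈ Finset.range (Fintype.card F),
        x ^ u * x ^ (Fintype.card F - 1 - u) = x ^ (Fintype.card F - 1) := by
      intro u hu
      have := Finset.mem_range.1 hu
      rw [← pow_add]
      congr 1
      omega
    rw [Finset.sum_congr rfl this]
    simp
  · have hg := (Commute.all x y).geom_sum₂_mul (Fintype.card F)
    rw [FiniteField.pow_card, FiniteField.pow_card] at hg
    have hne : x - y ≠ 0 := sub_ne_zero.2 h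
    have := mul_right_cancel₀ hne (hg.trans (one_mul _).symm)
    rw [this, sub_self]

theorem mat_expand (F : Type*) [Field F] [Fintype F] (m : F → F → F) :
    m = ∑ u ∈ Finset.range (Fintype.card F), ∑ v ∈ Finset.range (Fintype.card F),
      (∑ i, ∑ j, m i j * (dualMon F (Fintype.card F) u i * dualMon F (Fintype.card F) v j)) •
        vTensor F (fun α : F => α ^ u) (fun β : F => β ^ v) := by
  classical
  funext x y
  have h1 : m x y = ∑ i, ∑ j, m i j *
      ((∑ u ∈ Finset.range (Fintype.card F), x ^ u * dualMon F (Fintype.card F) u i) *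
       (∑ v ∈ Finset.range (Fintype.card F), y ^ v * dualMon F (Fintype.card F) v j)) := by
    simp only [dualMon_sum]
    simp
  rw [h1]
  simp only [Finset.sum_apply, Pi.smul_apply, smul_eq_mul, vTensor, LinearMap.coe_mk,
    AddHom.coe_mk, Finset.sum_mul, Finset.mul_sum]
  have e1 : ∀ (f : F → F → ℕ → ℕ → F) (s : Finset ℕ),
      ∑ i, ∑ j, ∑ v ∈ s, ∑ u ∈ s, f i j u v = ∑ u ∈ s, ∑ v ∈ s, ∑ i, ∑ j, f i j u v := by
    intro f s
    calc _ = ∑ i, ∑ v ∈ s, ∑ u ∈ s, ∑ j, f i j u v := by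
            refine Finset.sum_congr rfl fun i _ => ?_
            rw [Finset.sum_comm]
            exact Finset.sum_congr rfl fun v _ => Finset.sum_comm
      _ = ∑ v ∈ s, ∑ u ∈ s, ∑ i, ∑ j, f i j u v := by
            rw [Finset.sum_comm]
            exact Finset.sum_congr rfl fun v _ => Finset.sum_comm
      _ = _ := Finset.sum_comm
  first
  | rw [e1 (fun i j u v => m i j * (x ^ u * dualMon F (Fintype.card F) u i *
      (y ^ v * dualMon F (Fintype.card F) v j)))]
  | (rw [← e1 (fun i j u v => m i j * (dualMon F (Fintype.card F) u i *
      dualMon F (Fintype.card F) v j) * (x ^ u * y ^ v))])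
  refine Finset.sum_congr rfl fun _ _ => Finset.sum_congr rfl fun _ _ =>
    Finset.sum_congr rfl fun _ _ => Finset.sum_congr rfl fun _ _ => ?_
  ring

theorem vTensor_mem_CA (F : Type*) [Field F] (e a b d : ℕ) (hd : d ≤ a) (f : F → F)
    (hf : f ∈ RS F ((b : ℤ) - e * d + 1)) : vTensor F (fun α : F => α ^ d) f ∈ CA F e a b := by
  unfold CA
  exact Submodule.mem_iSup_of_mem d (Submodule.mem_iSup_of_mem (Finset.mem_Iic.2 hd)
    (Submodule.mem_map_of_mem hf))

theorem mem_dual_of (F : Type*) [Field F] [Fintype F] (e a b : ℕ) (m : F → F → F)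
    (h : ∀ d ≤ a, ∀ f ∈ RS F ((b : ℤ) - e * d + 1), ∑ i, ∑ j, m i j * (i ^ d * f j) = 0) :
    m ∈ dualCode2 F (CA F e a b) := by
  intro c hc
  let T : Submodule F (F → F → F) :=
    { carrier := {c | ∑ i, ∑ j, m i j * c i j = 0}
      zero_mem' := by simp
      add_mem' := by
        intro x y hx hy
        simp only [Set.mem_setOf_eq, Pi.add_apply, mul_add, Finset.sum_add_distrib] at *
        rw [hx, hy, add_zero]
      smul_mem' := by
        intro r x hx
        simp only [Set.mem_setOf_eq, Pi.smul_apply, smul_eq_mul, mul_left_comm _ r,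
          ← Finset.mul_sum] at *
        rw [hx, mul_zero] }
  have : CA F e a b ≤ T := by
    unfold CA
    refine iSup₂_le fun d hd => ?_
    rintro _ ⟨f, hf, rfl⟩
    exact h d (Finset.mem_Iic.1 hd) f hf
  exact this hc

/-- for `e ≥ 1` and `b - ea ≥ 0`,
`C_{𝔸,e}(a,b)^⊥ = C₁ + C₂` with
`C₁ = Σ_{d=0}^{q-1} ⟨(α^d)_α⟩ ⊗ RS_q(q-1-b+e(q-1-d))` and `C₂ = RS_q(q-a-1) ⊗ F^q`. -/
theorem CA_dual (F : Type*) [Field F] [Fintype F] (q e a b : ℕ)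
    (hq : Fintype.card F = q) (he : 1 ≤ e) (hb : e * a ≤ b) :
    dualCode2 F (CA F e a b) =
      (⨆ d ∈ Finset.Iic (q - 1),
        (RS F ((q : ℤ) - 1 - b + e * ((q : ℤ) - 1 - d))).map (vTensor F fun α : F => α ^ d))
      ⊔ colsIn F F (RS F ((q : ℤ) - a - 1)) := by
  subst hq
  have hpos : 0 < Fintype.card F := Fintype.card_pos
  apply le_antisymm
  · intro m hm
    rw [mat_expand F m]
    refine Submodule.sum_mem _ fun u hu => Submodule.sum_mem _ fun v hv => ?_
    rw [Finset.mem_range] at hu hv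
    by_cases h1 : (u : ℤ) < (Fintype.card F : ℤ) - a - 1
    · refine Submodule.smul_mem _ _ (Submodule.mem_sup_right ?_)
      intro j _
      change (fun i : F => i ^ u * j ^ v) ∈ RS F ((Fintype.card F : ℤ) - a - 1)
      have h := (RS F ((Fintype.card F : ℤ) - a - 1)).smul_mem (j ^ v) (pow_mem_RS F _ u h1)
      convert h using 1
      funext i
      simp [mul_comm]
    by_cases h2 : (v : ℤ) < (Fintype.card F : ℤ) - 1 - b + e * ((Fintype.card F : ℤ) - 1 - u)
    · refine Submodule.smul_mem _ _ (Submodule.mem_sup_left ?_)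
      exact Submodule.mem_iSup_of_mem u (Submodule.mem_iSup_of_mem
        (Finset.mem_Iic.2 (by omega)) (Submodule.mem_map_of_mem (pow_mem_RS F _ v h2)))
    have hd : Fintype.card F - 1 - u ≤ a := by omega
    have hcast : ((Fintype.card F - 1 - u : ℕ) : ℤ) = (Fintype.card F : ℤ) - 1 - u := by omega
    have hnn : (0 : ℤ) ≤ (e : ℤ) * ((Fintype.card F - 1 - u : ℕ) : ℤ) := by positivity
    have hv' : dualMon F (Fintype.card F) v ∈
        RS F ((b : ℤ) - e * ((Fintype.card F - 1 - u : ℕ) : ℤ) + 1) := by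
      rw [← hcast] at h2
      have hA := pow_mem_RS F ((b : ℤ) - e * ((Fintype.card F - 1 - u : ℕ) : ℤ) + 1)
        (Fintype.card F - 1 - v) (by omega)
      by_cases hv0 : v = 0
      · have hB := pow_mem_RS F ((b : ℤ) - e * ((Fintype.card F - 1 - u : ℕ) : ℤ) + 1) 0
          (by omega)
        convert Submodule.sub_mem _ hA hB using 1
        funext y
        simp [dualMon, hv0]
      · convert hA using 1
        funext y
        simp [dualMon, hv0]
    have hmem : (fun i j => dualMon F (Fintype.card F) u i * dualMon F (Fintype.card F) v j)
        ∈ CA F e a b := by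
      have hA := vTensor_mem_CA F e a b _ hd _ hv'
      by_cases hu0 : u = 0
      · have hB := vTensor_mem_CA F e a b 0 (Nat.zero_le _) _
          (RS_mono F (by push_cast at hnn ⊢; omega) hv')
        convert Submodule.sub_mem _ hA hB using 1
        funext x y
        simp [dualMon, hu0, vTensor, sub_mul]
      · convert hA using 1
        funext x y
        simp [dualMon, hu0, vTensor]
    have := hm _ hmem
    rw [this, zero_smul]
    exact Submodule.zero_mem _
  · refine sup_le (iSup₂_le fun u hu => ?_) ?_
    · rintro _ ⟨g, hg, rfl⟩
      rw [Finset.mem_Iic] at hu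
      refine mem_dual_of F e a b _ fun d hd f hf => ?_
      have hfac : ∑ i, ∑ j, vTensor F (fun α : F => α ^ u) g i j * (i ^ d * f j)
          = (∑ i : F, i ^ (u + d)) * ∑ j, g j * f j := by
        rw [Finset.sum_mul_sum]
        refine Finset.sum_congr rfl fun i _ => Finset.sum_congr rfl fun j _ => ?_
        simp only [vTensor, LinearMap.coe_mk, AddHom.coe_mk]
        ring
      rw [hfac]
      by_cases hud : u + d < Fintype.card F - 1
      · rw [FiniteField.sum_pow_lt_card_sub_one F _ hud, zero_mul]
      · rw [RS_orth F _ _ g f hg hf, mul_zero]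
        have h3 : (Fintype.card F : ℤ) - 1 - u - d ≤ 0 := by omega
        have h4 : (e : ℤ) * ((Fintype.card F : ℤ) - 1 - u - d) ≤ 0 :=
          mul_nonpos_of_nonneg_of_nonpos (by positivity) h3
        linarith
    · intro m hm
      refine mem_dual_of F e a b _ fun d hd f hf => ?_
      rw [Finset.sum_comm]
      refine Finset.sum_eq_zero fun j _ => ?_
      have hcol : (fun i => m i j) ∈ RS F ((Fintype.card F : ℤ) - a - 1) := hm j trivial
      have := RS_orth F _ _ _ _ hcol (pow_mem_RS F ((d : ℤ) + 1) d (by omega)) (by omega)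
      simp only [← mul_assoc]
      rw [← Finset.sum_mul, this, zero_mul]
end
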